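/- If a family of vectors {x_k}_{k=1}^m in ℝⁿ is injective, then m ≥ n(n+1)/2. -/

import Mathlib

open scoped InnerProductSpace

/-- The symmetric operator attached to a function on unordered pairs. -/
noncomputable def symOp (n : ℕ) (f : Sym2 (Fin n) → ℝ) :
    EuclideanSpace ℝ (Fin n) →L[ℝ] EuclideanSpace ℝ (Fin n) :=
  Matrix.toEuclideanCLM (n := Fin n) (𝕜 := ℝ) (Matrix.of fun i j => f s(i, j))

theorem symOp_add (n : ℕ) (f g : Sym2 (Fin n) → ℝ) :
    symOp n (f + g) = symOp n f + symOp n g := by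
  unfold symOp
  rw [← map_add]
  rfl

theorem symOp_smul (n : ℕ) (c : ℝ) (f : Sym2 (Fin n) → ℝ) :
    symOp n (c • f) = c • symOp n f := by
  unfold symOp
  rw [← map_smul]
  rfl

theorem symOp_sa (n : ℕ) (f : Sym2 (Fin n) → ℝ) : IsSelfAdjoint (symOp n f) := by
  unfold symOp
  apply IsSelfAdjoint.map
  ext i j
  simp [Matrix.star_apply, Sym2.eq_swap]

theorem symOp_inj (n : ℕ) (f : Sym2 (Fin n) → ℝ) (h : symOp n f = 0) : f = 0 := by
  unfold symOp at h
  rw [map_eq_zero_iff _ (EquivLike.injective _)] at h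
  ext z
  induction z with
  | h i j => exact congrFun (congrFun h i) j

/-- If a family of `m` vectors in `ℝⁿ` is injective (the only
self-adjoint operator `T` with `⟨T x_k, x_k⟩ = 0` for all `k` is `T = 0`),
then `m ≥ n(n+1)/2`. -/
theorem stmt_2 {n m : ℕ} (x : Fin m → EuclideanSpace ℝ (Fin n))
    (hinj : ∀ T : EuclideanSpace ℝ (Fin n) →L[ℝ] EuclideanSpace ℝ (Fin n),
      IsSelfAdjoint T → (∀ k, ⟪T (x k), x k⟫_ℝ = 0) → T = 0) :
    n * (n + 1) / 2 ≤ m := by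
  let L : (Sym2 (Fin n) → ℝ) →ₗ[ℝ] (Fin m → ℝ) :=
    { toFun := fun f k => ⟪symOp n f (x k), x k⟫_ℝ
      map_add' := fun f g => by
        ext k
        simp [symOp_add, inner_add_left]
      map_smul' := fun c f => by
        ext k
        simp [symOp_smul, real_inner_smul_left] }
  have hL : Function.Injective L := by
    rw [injective_iff_map_eq_zero]
    intro f hf
    exact symOp_inj n f (hinj _ (symOp_sa n f) fun k => congrFun hf k)
  have h := LinearMap.finrank_le_finrank_of_injective hL
  rw [Module.finrank_fintype_fun_eq_card, Module.finrank_fintype_fun_eq_card, Sym2.card,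
    Fintype.card_fin, Fintype.card_fin, Nat.choose_two_right] at h
  simpa [mul_comm] using h
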